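/- Let (Ω,𝒜,ℙ) be a probability space and Z : Ω × D → ℝ a jointly measurable stochastic process such that x ↦ Z(ω,x) is continuous for every ω ∈ Ω, and which is a centred Gaussian process: for every n ≥ 1, all points x^(1),…,x^(n) ∈ D and all b ∈ ℝⁿ, the random variable Σ_{i=1}^n b_i Z_{x^(i)} has a (possibly degenerate) centred Gaussian distribution. Then the family of pathwise FANOVA effects is jointly Gaussian: for every n ≥ 1, all points x^(1),…,x^(n) ∈ D and all real coefficients (a_i^{(u)})_{1≤i≤n, u⊆I}, the random variable Σ_{i=1}^n Σ_{u⊆I} a_i^{(u)} Z^{(u)}_{x^(i)} has a (possibly degenerate) centred Gaussian distribution. -/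

import Mathlib

open MeasureTheory Finset ProbabilityTheory

/-- Substitute the coordinates in `u` from `x`, the remaining coordinates from `z`. -/
def combine {d : ℕ} (D : Fin d → Set ℝ) (u : Finset (Fin d)) (x z : ∀ i, D i) : ∀ i, D i :=
  fun j => if j ∈ u then x j else z j

/-- FANOVA projection `T_u f (x) = ∑_{u'⊆u} (−1)^{|u|−|u'|} ∫ f(x) ν_{−u'}(dx_{−u'})`. -/
noncomputable def Tproj {d : ℕ} (D : Fin d → Set ℝ) (ν : ∀ i, Measure (D i))
    (u : Finset (Fin d)) (f : (∀ i, D i) → ℝ) : (∀ i, D i) → ℝ :=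
  fun x => ∑ u' ∈ u.powerset, (-1 : ℝ) ^ (u.card - u'.card) *
    ∫ z, f (combine D u' x z) ∂(Measure.pi ν)

open Topology Filter in
/-- A pointwise limit of centred Gaussian random variables is centred Gaussian. -/
theorem exists_map_eq_gaussianReal_of_tendsto {Ω : Type*} [MeasurableSpace Ω] {P : Measure Ω}
    [IsProbabilityMeasure P] {Y : ℕ → Ω → ℝ} {X : Ω → ℝ} (hY : ∀ m, Measurable (Y m))
    (hgauss : ∀ m, ∃ v : NNReal, P.map (Y m) = gaussianReal 0 v)
    (hlim : ∀ ω, Tendsto (fun m => Y m ω) atTop (𝓝 (X ω))) :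
    ∃ v : NNReal, P.map X = gaussianReal 0 v := by
  choose v hv using hgauss
  have hX : Measurable X := measurable_of_tendsto_metrizable hY (tendsto_pi_nhds.2 hlim)
  have : IsProbabilityMeasure (P.map X) := Measure.isProbabilityMeasure_map hX.aemeasurable
  have hchar : ∀ t : ℝ, Tendsto (fun m => Complex.exp (-((v m : ℝ) * t ^ 2 / 2 : ℝ))) atTop
      (𝓝 (charFun (P.map X) t)) := by
    intro t
    have key : Tendsto (fun m => charFun (P.map (Y m)) t) atTop (𝓝 (charFun (P.map X) t)) := by
      simp only [charFun_apply_real]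
      rw [integral_map hX.aemeasurable (by fun_prop)]
      simp_rw [fun m => integral_map (μ := P) (hY m).aemeasurable
        (f := fun x : ℝ => Complex.exp (t * x * Complex.I)) (by fun_prop)]
      refine tendsto_integral_of_dominated_convergence (fun _ => 1)
        (fun m => ?_) (integrable_const _) (fun m => ?_) ?_
      · have := hY m
        exact (by fun_prop : Measurable _).aestronglyMeasurable
      · refine .of_forall fun ω => ?_
        rw [← Complex.ofReal_mul, Complex.norm_exp_ofReal_mul_I]
      · refine .of_forall fun ω => ?_
        have hc : Continuous fun x : ℝ => Complex.exp (t * x * Complex.I) := by fun_prop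
        exact (hc.tendsto _).comp (hlim ω)
    refine key.congr fun m => ?_
    rw [hv m, charFun_gaussianReal]
    congr 1
    push_cast
    ring
  obtain ⟨t₀, ht₀, hne⟩ : ∃ t₀ : ℝ, t₀ ≠ 0 ∧ charFun (P.map X) t₀ ≠ 0 := by
    have hc : ContinuousAt (charFun (P.map X)) 0 := by fun_prop
    have hev : ∀ᶠ t in 𝓝[≠] (0 : ℝ), charFun (P.map X) t ≠ 0 :=
      (hc.eventually_ne (by simp)).filter_mono nhdsWithin_le_nhds
    obtain ⟨t, h, h'⟩ := (hev.and self_mem_nhdsWithin).exists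
    exact ⟨t, h', h⟩
  have hlog : Tendsto (fun m => -((v m : ℝ) * t₀ ^ 2 / 2)) atTop
      (𝓝 (Real.log ‖charFun (P.map X) t₀‖)) := by
    refine ((hchar t₀).norm.log (norm_ne_zero_iff.2 hne)).congr fun m => ?_
    rw [← Complex.ofReal_neg, ← Complex.ofReal_exp, Complex.norm_real, Real.norm_eq_abs,
      Real.abs_exp, Real.log_exp]
  obtain ⟨w, hw⟩ : ∃ w : ℝ, Tendsto (fun m => (v m : ℝ)) atTop (𝓝 w) := by
    refine ⟨_, (hlog.mul_const (-(2 / t₀ ^ 2))).congr fun m => ?_⟩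
    field_simp
  have hw0 : 0 ≤ w := ge_of_tendsto' hw fun m => (v m).2
  lift w to NNReal using hw0
  refine ⟨w, Measure.ext_of_charFun (funext fun t => ?_)⟩
  have hc : Continuous fun x : ℝ => Complex.exp (-(x * t ^ 2 / 2 : ℝ)) := by fun_prop
  rw [tendsto_nhds_unique (hchar t) ((hc.tendsto w).comp hw), charFun_gaussianReal]
  congr 1
  push_cast
  ring

theorem continuous_combine {d : ℕ} (D : Fin d → Set ℝ) (u : Finset (Fin d)) (x : ∀ i, D i) :
    Continuous (combine D u x) := by
  refine continuous_pi fun j => ?_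
  unfold combine
  split_ifs <;> fun_prop

open Topology Filter in
/-- The integral of a continuous function on a compact space is the limit of the integrals of its
compositions with the simple functions approximating the identity. -/
theorem tendsto_integral_comp_approx_id {E : Type*} [TopologicalSpace E] [CompactSpace E]
    [TopologicalSpace.PseudoMetrizableSpace E] [SecondCountableTopology E] [MeasurableSpace E]
    [BorelSpace E] (μ : Measure E) [IsFiniteMeasure μ] {f : E → ℝ} (hf : Continuous f) :
    Tendsto (fun m => ∫ z, f ((stronglyMeasurable_id (α := E)).approx m z) ∂μ) atTop
      (𝓝 (∫ z, f z ∂μ)) := by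
  obtain ⟨C, hC⟩ := isCompact_univ.exists_bound_of_continuousOn hf.continuousOn
  refine tendsto_integral_of_dominated_convergence (fun _ => C) (fun m => ?_)
    (integrable_const _) (fun m => .of_forall fun z => hC _ (Set.mem_univ _))
    (.of_forall fun z => ?_)
  · exact (hf.measurable.comp (SimpleFunc.measurable _)).aestronglyMeasurable
  · exact (hf.tendsto _).comp (stronglyMeasurable_id.tendsto_approx z)

/-- Integrating a random field along a simple function gives a linear combination of its values. -/
theorem integral_simpleFunc_mem_span {Ω E F : Type*} [MeasurableSpace E] (μ : Measure E)
    [IsFiniteMeasure μ] (Z : Ω → F → ℝ) (s : SimpleFunc E F) :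
    (fun ω => ∫ z, Z ω (s z) ∂μ) ∈
      Submodule.span ℝ (Set.range fun (x : F) (ω : Ω) => Z ω x) := by
  have h : (fun ω => ∫ z, Z ω (s z) ∂μ) =
      ∑ y ∈ s.range, μ.real (s ⁻¹' {y}) • fun ω => Z ω y := by
    funext ω
    rw [Finset.sum_apply]
    have hpt : ∀ z, Z ω (s z) = ∑ y ∈ s.range, (s ⁻¹' {y}).indicator (fun _ => Z ω y) z := by
      intro z
      rw [Finset.sum_eq_single_of_mem (s z) (s.mem_range_self z)]
      · simp
      · intro y _ hy
        exact Set.indicator_of_notMem (fun hz => hy hz.symm) _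
    simp_rw [hpt]
    rw [integral_finsetSum _ fun y _ => (integrable_const _).indicator (s.measurableSet_fiber y)]
    refine Finset.sum_congr rfl fun y _ => ?_
    rw [integral_indicator_const _ (s.measurableSet_fiber y), Pi.smul_apply]
  rw [h]
  exact Submodule.sum_mem _ fun y _ => Submodule.smul_mem _ _ (Submodule.subset_span ⟨y, rfl⟩)

/-- **Joint Gaussianity of the FANOVA effects of a Gaussian random field.**
If `Z` is a jointly measurable centred Gaussian process with continuous sample paths
(i.e. every finite linear combination `∑ b_i Z_{x^{(i)}}` has a possibly degenerate
centred Gaussian distribution), then the family of pathwise FANOVA effects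
`Z^{(u)} = T_u Z`, `u ⊆ I`, is jointly Gaussian: every finite linear combination
`∑_i ∑_{u⊆I} a_i^{(u)} Z^{(u)}_{x^{(i)}}` has a (possibly degenerate) centred Gaussian
distribution. -/
theorem fanova_effects_jointly_gaussian {d : ℕ} (hd : 1 ≤ d)
    (a b : Fin d → ℝ) (hab : ∀ i, a i < b i)
    (D : Fin d → Set ℝ) (hD : ∀ i, D i = Set.Icc (a i) (b i))
    (ν : ∀ i, Measure (D i)) [∀ i, IsProbabilityMeasure (ν i)]
    {Ω : Type*} [MeasurableSpace Ω] (P : Measure Ω) [IsProbabilityMeasure P]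
    (Z : Ω → (∀ i, D i) → ℝ)
    (hZ_meas : Measurable (fun p : Ω × (∀ i, D i) => Z p.1 p.2))
    (hZ_cont : ∀ ω, Continuous (Z ω))
    (hZ_gauss : ∀ (n : ℕ) (x : Fin n → ∀ i, D i) (c : Fin n → ℝ),
      ∃ v : NNReal,
        P.map (fun ω => ∑ i : Fin n, c i * Z ω (x i)) = gaussianReal 0 v) :
    ∀ (n : ℕ) (x : Fin n → ∀ i, D i) (coeff : Fin n → Finset (Fin d) → ℝ),
      ∃ v : NNReal,
        P.map (fun ω => ∑ i : Fin n, ∑ u : Finset (Fin d),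
            coeff i u * Tproj D ν u (Z ω) (x i)) = gaussianReal 0 v := by
  intro n x coeff
  have : ∀ i, CompactSpace (D i) := fun i =>
    isCompact_iff_compactSpace.1 (hD i ▸ isCompact_Icc)
  have hspan : ∀ Y ∈ Submodule.span ℝ (Set.range fun (x : ∀ i, D i) (ω : Ω) => Z ω x),
      Measurable Y ∧ ∃ v : NNReal, P.map Y = gaussianReal 0 v := by
    intro Y hY
    obtain ⟨k, c, g, rfl⟩ := Submodule.mem_span_set'.1 hY
    choose y hy using fun i => (g i).2
    have heq : ∑ i, c i • (g i : Ω → ℝ) = fun ω => ∑ i, c i * Z ω (y i) := by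
      funext ω
      simp [← hy]
    rw [heq]
    refine ⟨Finset.measurable_sum _ fun i _ => ?_, hZ_gauss k y c⟩
    exact (hZ_meas.comp (measurable_id.prodMk measurable_const)).const_mul _
  let s := (stronglyMeasurable_id (α := ∀ i, D i)).approx
  have hmem : ∀ m, (fun ω => ∑ i : Fin n, ∑ u : Finset (Fin d), coeff i u *
      ∑ u' ∈ u.powerset, (-1 : ℝ) ^ (u.card - u'.card) *
        ∫ z, Z ω (combine D u' (x i) (s m z)) ∂(Measure.pi ν)) ∈
      Submodule.span ℝ (Set.range fun (x : ∀ i, D i) (ω : Ω) => Z ω x) := by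
    intro m
    have heq : (fun ω => ∑ i : Fin n, ∑ u : Finset (Fin d), coeff i u *
        ∑ u' ∈ u.powerset, (-1 : ℝ) ^ (u.card - u'.card) *
          ∫ z, Z ω (combine D u' (x i) (s m z)) ∂(Measure.pi ν)) =
        ∑ i : Fin n, ∑ u : Finset (Fin d), coeff i u •
          ∑ u' ∈ u.powerset, (-1 : ℝ) ^ (u.card - u'.card) •
            fun ω => ∫ z, Z ω (combine D u' (x i) (s m z)) ∂(Measure.pi ν) := by
      funext ω
      simp [Finset.sum_apply]
    rw [heq]
    refine Submodule.sum_mem _ fun i _ => Submodule.sum_mem _ fun u _ =>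
      Submodule.smul_mem _ _ (Submodule.sum_mem _ fun u' _ => Submodule.smul_mem _ _ ?_)
    exact integral_simpleFunc_mem_span (Measure.pi ν) Z ((s m).map (combine D u' (x i)))
  refine exists_map_eq_gaussianReal_of_tendsto (fun m => (hspan _ (hmem m)).1)
    (fun m => (hspan _ (hmem m)).2) fun ω => ?_
  unfold Tproj
  refine tendsto_finsetSum _ fun i _ => tendsto_finsetSum _ fun u _ => Filter.Tendsto.const_mul _
    (tendsto_finsetSum _ fun u' _ => Filter.Tendsto.const_mul _ ?_)
  exact tendsto_integral_comp_approx_id (Measure.pi ν)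
    ((hZ_cont ω).comp (continuous_combine D u' (x i)))
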